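/- arXiv:1707.05563 — 2 statements merged into one kernel-verified Lean document; each statement's English description precedes it below -/
import Mathlib

section
/- With K, σ₁, σ₂ and the operators D̂₁, D̂₂, D̂₃, D̂₄ : K → K as in the context (type B₂ Demazure-type operators), the operator identity D̂₁∘D̂₂∘D̂₃∘D̂₄ = D̂₄∘D̂₃∘D̂₂∘D̂₁ holds; that is, for every f ∈ K, D̂₁(D̂₂(D̂₃(D̂₄(f)))) = D̂₄(D̂₃(D̂₂(D̂₁(f)))). (Lemma 2.3(2).) -/
noncomputable section

local notation "K" => FractionRing (MvPolynomial (Fin 2) ℤ)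

noncomputable def t1 : FractionRing (MvPolynomial (Fin 2) ℤ) :=
  algebraMap (MvPolynomial (Fin 2) ℤ) _ (MvPolynomial.X 0)

noncomputable def t2 : FractionRing (MvPolynomial (Fin 2) ℤ) :=
  algebraMap (MvPolynomial (Fin 2) ℤ) _ (MvPolynomial.X 1)

theorem one_sub_inv_inv {F : Type*} [Field F] {x : F} (hx : x ≠ 0) (hx1 : 1 - x ≠ 0) :
    (1 - x⁻¹)⁻¹ = 1 - (1 - x)⁻¹ := by
  have : x - 1 ≠ 0 := by rwa [← neg_sub, neg_ne_zero]
  field_simp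
  ring

theorem FractionRing.mvPolynomial_ringHom_ext {φ ψ : K →+* K}
    (h1 : φ t1 = ψ t1) (h2 : φ t2 = ψ t2) : φ = ψ := by
  refine IsLocalization.ringHom_ext (nonZeroDivisors (MvPolynomial (Fin 2) ℤ)) ?_
  refine MvPolynomial.ringHom_ext (fun r => by simp) (fun i => ?_)
  fin_cases i
  · exact h1
  · exact h2

/-- A polynomial with a nonzero value at an integer point is nonzero in the fraction field. -/
theorem algebraMap_ne_zero_of_eval_ne_zero {p : MvPolynomial (Fin 2) ℤ} (v : Fin 2 → ℤ)
    (h : MvPolynomial.eval v p ≠ 0) : algebraMap (MvPolynomial (Fin 2) ℤ) K p ≠ 0 := by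
  intro hp
  rw [FaithfulSMul.algebraMap_eq_zero_iff] at hp
  simp [hp] at h

theorem t1_ne_zero : t1 ≠ 0 :=
  algebraMap_ne_zero_of_eval_ne_zero (fun _ => 2) (by simp)

theorem t2_ne_zero : t2 ≠ 0 :=
  algebraMap_ne_zero_of_eval_ne_zero (fun _ => 2) (by simp)

theorem one_sub_t1_pow_mul_t2_pow_ne_zero {a b : ℕ} (h : a + b ≠ 0) :
    1 - t1 ^ a * t2 ^ b ≠ 0 := by
  have := algebraMap_ne_zero_of_eval_ne_zero
    (p := 1 - MvPolynomial.X 0 ^ a * MvPolynomial.X 1 ^ b) (fun _ => 2) (by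
      have : (1 : ℤ) < 2 ^ (a + b) := one_lt_pow₀ (by norm_num) h
      simp only [map_sub, map_one, map_mul, map_pow, MvPolynomial.eval_X, ← pow_add]
      omega)
  simpa [t1, t2] using this

theorem stmt_6 (σ1 σ2 : K ≃+* K)
    (h11 : σ1 t1 = t1⁻¹) (h12 : σ1 t2 = t1 ^ 2 * t2)
    (h21 : σ2 t1 = t1 * t2) (h22 : σ2 t2 = t2⁻¹)
    (D1 D2 : K → K)
    (hD1 : ∀ f, D1 f = (1 - t1)⁻¹ * (f - σ1 f))
    (hD2 : ∀ f, D2 f = (1 - t2)⁻¹ * (f - σ2 f))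
    (Dh1 Dh2 Dh3 Dh4 : K → K)
    (hDh1 : Dh1 = D1)
    (hDh2 : Dh2 = ⇑σ1 ∘ D2 ∘ ⇑σ1)
    (hDh3 : Dh3 = ⇑σ2 ∘ D1 ∘ ⇑σ2)
    (hDh4 : Dh4 = D2) :
    ∀ f : K, Dh1 (Dh2 (Dh3 (Dh4 f))) = Dh4 (Dh3 (Dh2 (Dh1 f))) := by
  have inv1 (x : K) : σ1 (σ1 x) = x := by
    refine RingHom.congr_fun (FractionRing.mvPolynomial_ringHom_ext
      (φ := (σ1 : K →+* K).comp σ1) (ψ := RingHom.id K) ?_ ?_) x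
    · simp [h11]
    · simp [h11, h12, t1_ne_zero]
  have inv2 (x : K) : σ2 (σ2 x) = x := by
    refine RingHom.congr_fun (FractionRing.mvPolynomial_ringHom_ext
      (φ := (σ2 : K →+* K).comp σ2) (ψ := RingHom.id K) ?_ ?_) x
    · simp [h21, h22, t2_ne_zero]
    · simp [h22]
  have braid (x : K) : σ2 (σ1 (σ2 (σ1 x))) = σ1 (σ2 (σ1 (σ2 x))) := by
    have ht1 := t1_ne_zero
    have ht2 := t2_ne_zero
    refine RingHom.congr_fun (FractionRing.mvPolynomial_ringHom_ext
      (φ := (σ2 : K →+* K).comp ((σ1 : K →+* K).comp ((σ2 : K →+* K).comp σ1)))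
      (ψ := (σ1 : K →+* K).comp ((σ2 : K →+* K).comp ((σ1 : K →+* K).comp σ2))) ?_ ?_) x
    · simp [h11, h12, h21, h22]
      field_simp
    · simp [h11, h12, h21, h22]
      field_simp
  have ht1 := t1_ne_zero
  have ht2 := t2_ne_zero
  have n1 : 1 - t1 ≠ 0 := by
    simpa using one_sub_t1_pow_mul_t2_pow_ne_zero (a := 1) (b := 0) (by simp)
  have n2 : 1 - t2 ≠ 0 := by
    simpa using one_sub_t1_pow_mul_t2_pow_ne_zero (a := 0) (b := 1) (by simp)
  have n3 : 1 - t1 * t2 ≠ 0 := by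
    simpa using one_sub_t1_pow_mul_t2_pow_ne_zero (a := 1) (b := 1) (by simp)
  have n4 : 1 - t1 ^ 2 * t2 ≠ 0 := by
    simpa using one_sub_t1_pow_mul_t2_pow_ne_zero (a := 2) (b := 1) (by simp)
  obtain ⟨p, hp⟩ : ∃ p, p = (1 - t1)⁻¹ := ⟨_, rfl⟩
  obtain ⟨q, hq⟩ : ∃ q, q = (1 - t2)⁻¹ := ⟨_, rfl⟩
  obtain ⟨r, hr⟩ : ∃ r, r = (1 - t1 * t2)⁻¹ := ⟨_, rfl⟩
  obtain ⟨s, hs⟩ : ∃ s, s = (1 - t1 ^ 2 * t2)⁻¹ := ⟨_, rfl⟩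
  have hpqr : r * (p + q - 1) = p * q := by
    rw [hp, hq, hr]
    field_simp
    ring
  have hprs : s * (p + r - 1) = p * r := by
    rw [hp, hr, hs]
    field_simp
    ring
  have h1p : σ1 p = 1 - p := by
    rw [hp, map_inv₀, map_sub, map_one, h11, one_sub_inv_inv ht1 n1]
  have h1q : σ1 q = s := by rw [hq, hs, map_inv₀, map_sub, map_one, h12]
  have h1r : σ1 r = r := by
    rw [hr, map_inv₀, map_sub, map_one, map_mul, h11, h12]
    congr 2
    field_simp
  have h1s : σ1 s = q := by rw [← h1q, inv1]
  have h2q : σ2 q = 1 - q := by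
    rw [hq, map_inv₀, map_sub, map_one, h22, one_sub_inv_inv ht2 n2]
  have h2p : σ2 p = r := by rw [hp, hr, map_inv₀, map_sub, map_one, h21]
  have h2r : σ2 r = p := by rw [← h2p, inv2]
  have h2s : σ2 s = s := by
    rw [hs, map_inv₀, map_sub, map_one, map_mul, map_pow, h21, h22]
    congr 2
    field_simp
  rw [← hp] at hD1
  rw [← hq] at hD2
  intro f
  subst hDh1 hDh2 hDh3 hDh4
  simp only [Function.comp_apply, hD1, hD2, map_mul, map_sub, map_one,
    inv1, inv2, braid, h1p, h1q, h1r, h1s, h2p, h2q, h2r, h2s]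
  generalize σ1 (σ2 (σ1 (σ2 f))) = f7
  generalize σ1 (σ2 (σ1 f)) = f6
  generalize σ2 (σ1 (σ2 f)) = f5
  generalize σ1 (σ2 f) = f4
  generalize σ2 (σ1 f) = f3
  generalize σ1 f = f2
  generalize σ2 f = f1
  clear * - hpqr hprs
  grind
end
end

section
/- With K, σ₁, σ₂ and the operators D̃₁, …, D̃₆ : K → K as in the context (type G₂ Demazure-type operators), the operators D̃₃ and D̃₆ commute: D̃₃∘D̃₆ = D̃₆∘D̃₃, i.e., for every f ∈ K, D̃₃(D̃₆(f)) = D̃₆(D̃₃(f)). (Lemma 3.3(2).) -/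
noncomputable section

local notation "K" => FractionRing (MvPolynomial (Fin 2) ℤ)

theorem ringHom_ext_t1_t2 {φ ψ : FractionRing (MvPolynomial (Fin 2) ℤ) →+*
    FractionRing (MvPolynomial (Fin 2) ℤ)} (h1 : φ t1 = ψ t1) (h2 : φ t2 = ψ t2) : φ = ψ := by
  refine IsLocalization.ringHom_ext (nonZeroDivisors (MvPolynomial (Fin 2) ℤ)) ?_
  refine MvPolynomial.ringHom_ext (fun r => by simp) fun i => ?_
  fin_cases i
  · exact h1
  · exact h2

theorem stmt_14 (σ1 σ2 : K ≃+* K)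
    (h11 : σ1 t1 = t1⁻¹) (h12 : σ1 t2 = t1 ^ 3 * t2)
    (h21 : σ2 t1 = t1 * t2) (h22 : σ2 t2 = t2⁻¹)
    (D1 D2 : K → K)
    (hD1 : ∀ f, D1 f = (1 - t1)⁻¹ * (f - σ1 f))
    (hD2 : ∀ f, D2 f = (1 - t2)⁻¹ * (f - σ2 f))
    (Dt1 Dt2 Dt3 Dt4 Dt5 Dt6 : K → K)
    (hDt1 : Dt1 = D1)
    (hDt2 : Dt2 = ⇑σ1 ∘ D2 ∘ ⇑σ1)
    (hDt3 : Dt3 = ⇑σ1 ∘ ⇑σ2 ∘ D1 ∘ ⇑σ2 ∘ ⇑σ1)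
    (hDt4 : Dt4 = ⇑σ2 ∘ ⇑σ1 ∘ D2 ∘ ⇑σ1 ∘ ⇑σ2)
    (hDt5 : Dt5 = ⇑σ2 ∘ D1 ∘ ⇑σ2)
    (hDt6 : Dt6 = D2) :
    ∀ f : K, Dt3 (Dt6 f) = Dt6 (Dt3 f) := by
  have h0 := t1_ne_zero
  have h0' := t2_ne_zero
  have inv1 : ∀ f, σ1 (σ1 f) = f := RingHom.congr_fun (ringHom_ext_t1_t2
    (φ := (σ1 : K →+* K).comp σ1) (ψ := RingHom.id _)
    (by simp [h11]) (by simp [h11, h12]; field_simp))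
  have inv2 : ∀ f, σ2 (σ2 f) = f := RingHom.congr_fun (ringHom_ext_t1_t2
    (φ := (σ2 : K →+* K).comp σ2) (ψ := RingHom.id _)
    (by simp [h21, h22]; field_simp) (by simp [h22]))
  let w : K →+* K := (σ1 : K →+* K).comp <| (σ2 : K →+* K).comp <|
    (σ1 : K →+* K).comp <| (σ2 : K →+* K).comp σ1
  have w_apply : ∀ f, w f = σ1 (σ2 (σ1 (σ2 (σ1 f)))) := fun _ => rfl
  have w_t1 : w t1 = t1⁻¹ * t2⁻¹ := by
    simp only [w_apply, h11, h12, h21, h22, map_mul, map_inv₀, map_pow]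
    field_simp
  have w_t2 : w t2 = t2 := by
    simp only [w_apply, h11, h12, h21, h22, map_mul, map_inv₀, map_pow]
    field_simp
  have w_comm : ∀ f, w (σ2 f) = σ2 (w f) := RingHom.congr_fun (ringHom_ext_t1_t2
    (φ := w.comp σ2) (ψ := (σ2 : K →+* K).comp w)
    (by simp [h21, h22, w_t1, w_t2, h0']; field_simp) (by simp [h22, w_t2]))
  have T3 : σ1 (σ2 t1) = t1 ^ 2 * t2 := by
    simp only [h11, h12, h21, map_mul]
    field_simp
  have T3_fixed : σ2 (t1 ^ 2 * t2) = t1 ^ 2 * t2 := by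
    simp only [h21, h22, map_mul, map_pow]
    field_simp
  have hDt3_apply : ∀ f, Dt3 f = (1 - t1 ^ 2 * t2)⁻¹ * (f - w f) := fun f => by
    simp only [hDt3, Function.comp_apply, hD1, map_mul, map_inv₀, map_sub, map_one, inv1, inv2]
    rw [T3, w_apply]
  intro f
  simp only [hDt6, hD2, hDt3_apply, map_mul, map_inv₀, map_sub, map_one, w_t2, T3_fixed, w_comm]
  ring
end
end
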